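/- Let K ≥ 2 be an integer, m = 3K, and h > 0. Let A be the (m+1)×(m+1) real matrix with rows and columns indexed by 0, 1, …, m defined by: row 0 and row m are h²/4 times the corresponding identity rows, and for 1 ≤ i ≤ m−1, the i-th row has entries A(i,k) = a(i,k). Then A can be written as a product of three nonsingular M-matrices; in particular A is invertible and A⁻¹ ≥ 0 entrywise. -/

import Mathlib

/-- A nonsingular M-matrix: a Z-matrix (nonpositive off-diagonal entries) that is
invertible with entrywise nonnegative inverse. -/
def IsNonsingularMMatrix {N : ℕ} (A : Matrix (Fin N) (Fin N) ℝ) : Prop :=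
  (∀ i j, i ≠ j → A i j ≤ 0) ∧ IsUnit A ∧ ∀ i j, 0 ≤ A⁻¹ i j

/-- The 1D `Q³` stencil coefficients `a(i,k)` (used for interior rows `1 ≤ i ≤ m-1`):
knots are indices `i ≡ 0 (mod 3)`, left interior points `i ≡ 1 (mod 3)`, and right
interior points `i ≡ 2 (mod 3)`. -/
noncomputable def q3a (i k : ℕ) : ℝ :=
  if i % 3 = 0 then
    -- knot
    if k = i then 13
    else if k = i + 1 ∨ k + 1 = i then -(15 * Real.sqrt 5 + 25) / 8
    else if k = i + 2 ∨ k + 2 = i then (15 * Real.sqrt 5 - 25) / 8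
    else if k = i + 3 ∨ k + 3 = i then -(1 / 4)
    else 0
  else if i % 3 = 1 then
    -- left interior point
    if k + 1 = i then -(3 * Real.sqrt 5 + 5) / 4
    else if k = i then 5
    else if k = i + 1 then -(5 / 2)
    else if k = i + 2 then (15 * Real.sqrt 5 - 25) / 8
    else 0
  else
    -- right interior point
    if k + 2 = i then (15 * Real.sqrt 5 - 25) / 8
    else if k + 1 = i then -(5 / 2)
    else if k = i then 5
    else if k = i + 1 then -(3 * Real.sqrt 5 + 5) / 4
    else 0

/-- `(h²/4)` times the matrix of the 1D `Q³` variational difference scheme for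
`-u'' = f` on a uniform mesh of `K` cells with Dirichlet boundary conditions. -/
noncomputable def q3Matrix1D (K : ℕ) (h : ℝ) :
    Matrix (Fin (3 * K + 1)) (Fin (3 * K + 1)) ℝ :=
  fun i k =>
    if i.val = 0 ∨ i.val = 3 * K then (if k = i then h ^ 2 / 4 else 0)
    else q3a i.val k.val

open Matrix in
/-- A Z-matrix that maps some positive vector to a positive vector is a nonsingular M-matrix. -/
theorem IsNonsingularMMatrix.of_mulVec_pos {N : ℕ} (A : Matrix (Fin N) (Fin N) ℝ)
    (hZ : ∀ i j, i ≠ j → A i j ≤ 0) (v : Fin N → ℝ) (hv : ∀ i, 0 < v i)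
    (hAv : ∀ i, 0 < (A *ᵥ v) i) : IsNonsingularMMatrix A := by
  have key : ∀ x : Fin N → ℝ, (∀ i, 0 ≤ (A *ᵥ x) i) → ∀ i, 0 ≤ x i := by
    intro x hx i
    obtain ⟨i₀, -, hi₀⟩ := Finset.exists_min_image Finset.univ (fun j => x j / v j)
      ⟨i, Finset.mem_univ i⟩
    set t := x i₀ / v i₀ with ht
    have hle : ∀ j, t * v j ≤ x j := fun j => (le_div_iff₀ (hv j)).1 (hi₀ j (Finset.mem_univ j))
    have heq : x i₀ = t * v i₀ := by rw [ht, div_mul_cancel₀ _ (hv i₀).ne']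
    have hsum : (A *ᵥ x) i₀ ≤ t * (A *ᵥ v) i₀ := by
      simp only [mulVec, dotProduct, Finset.mul_sum]
      refine Finset.sum_le_sum fun j _ => ?_
      by_cases hj : i₀ = j
      · subst hj
        rw [heq]
        exact le_of_eq (by ring)
      · nlinarith [hle j, hZ i₀ j hj]
    have ht0 : 0 ≤ t := nonneg_of_mul_nonneg_left ((hx i₀).trans hsum) (hAv i₀)
    exact (mul_nonneg ht0 (hv i).le).trans (hle i)
  have hU : IsUnit A := by
    rw [← mulVec_injective_iff_isUnit]
    intro x y hxy
    have hxy : A *ᵥ x = A *ᵥ y := hxy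
    ext i
    have h1 := key (x - y) (fun i => by simp [mulVec_sub, hxy]) i
    have h2 := key (y - x) (fun i => by simp [mulVec_sub, hxy]) i
    simp only [Pi.sub_apply] at h1 h2
    linarith
  refine ⟨hZ, hU, fun i j => ?_⟩
  refine key (fun k => A⁻¹ k j) (fun k => ?_) i
  have h1 : (A * A⁻¹) k j = (1 : Matrix (Fin N) (Fin N) ℝ) k j := by
    rw [mul_nonsing_inv _ ((isUnit_iff_isUnit_det A).1 hU)]
  change 0 ≤ (A * A⁻¹) k j
  rw [h1, one_apply]
  split_ifs <;> norm_num

/-- Kronecker's delta on the natural numbers, with real values. -/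
def kronecker (k c : ℕ) : ℝ := if k = c then 1 else 0

theorem kronecker_nonneg (k c : ℕ) : 0 ≤ kronecker k c := by
  unfold kronecker
  split_ifs <;> norm_num

theorem kronecker_of_ne {k c : ℕ} (h : k ≠ c) : kronecker k c = 0 := if_neg h

theorem sum_kronecker_mul {n c : ℕ} (hc : c < n) (g : ℕ → ℝ) :
    ∑ j ∈ Finset.range n, kronecker j c * g j = g c := by
  simp [kronecker, hc]

/-- Lower triangular factor of the block LDU factorization that eliminates the interior points. -/
noncomputable def q3Lower (K i k : ℕ) : ℝ :=
  if i % 3 = 0 ∧ i ≠ 0 ∧ i ≠ 3 * K then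
    kronecker k i
      - (√5 + 5) / 4 * (kronecker k (i - 1) + kronecker k (i + 1))
      - (5 - √5) / 4 * (kronecker k (i - 2) + kronecker k (i + 2))
  else kronecker k i

/-- Block diagonal factor of the block LDU factorization that eliminates the interior points. -/
noncomputable def q3Diag (K : ℕ) (h : ℝ) (i k : ℕ) : ℝ :=
  if i = 0 ∨ i = 3 * K then h ^ 2 / 4 * kronecker k i
  else if i % 3 = 0 then
    (15 * √5 - 18) / 4 * kronecker k i
      - (39 - 15 * √5) / 16 * (kronecker k (i - 3) + kronecker k (i + 3))
  else if i % 3 = 1 then 5 * kronecker k i - 5 / 2 * kronecker k (i + 1)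
  else 5 * kronecker k i - 5 / 2 * kronecker k (i - 1)

/-- Upper triangular factor of the block LDU factorization that eliminates the interior points. -/
noncomputable def q3Upper (i k : ℕ) : ℝ :=
  if i % 3 = 0 then kronecker k i
  else if i % 3 = 1 then
    kronecker k i - (15 - √5) / 20 * kronecker k (i - 1) - (5 - 2 * √5) / 5 * kronecker k (i + 2)
  else
    kronecker k i - (15 - √5) / 20 * kronecker k (i + 1) - (5 - 2 * √5) / 5 * kronecker k (i - 2)

section Rows

variable (K q : ℕ) (h : ℝ)

theorem q3Lower_zero : q3Lower K 0 = fun k => kronecker k 0 := by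
  funext k; simp [q3Lower]

theorem q3Lower_last : q3Lower K (3 * K) = fun k => kronecker k (3 * K) := by
  funext k; simp [q3Lower]

theorem q3Lower_left : q3Lower K (3 * q + 1) = fun k => kronecker k (3 * q + 1) := by
  funext k; rw [q3Lower, if_neg (by omega)]

theorem q3Lower_right : q3Lower K (3 * q + 2) = fun k => kronecker k (3 * q + 2) := by
  funext k; rw [q3Lower, if_neg (by omega)]

theorem q3Lower_knot {K q : ℕ} (hq : q + 1 < K) : q3Lower K (3 * q + 3) = fun k =>
    kronecker k (3 * q + 3)
      - (√5 + 5) / 4 * (kronecker k (3 * q + 2) + kronecker k (3 * q + 4))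
      - (5 - √5) / 4 * (kronecker k (3 * q + 1) + kronecker k (3 * q + 5)) := by
  funext k; rw [q3Lower, if_pos (by omega)]; rfl

theorem q3Diag_zero : q3Diag K h 0 = fun k => h ^ 2 / 4 * kronecker k 0 := by
  funext k; simp [q3Diag]

theorem q3Diag_last : q3Diag K h (3 * K) = fun k => h ^ 2 / 4 * kronecker k (3 * K) := by
  funext k; simp [q3Diag]

theorem q3Diag_left : q3Diag K h (3 * q + 1) = fun k =>
    5 * kronecker k (3 * q + 1) - 5 / 2 * kronecker k (3 * q + 2) := by
  funext k; rw [q3Diag, if_neg (by omega), if_neg (by omega), if_pos (by omega)]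

theorem q3Diag_right : q3Diag K h (3 * q + 2) = fun k =>
    5 * kronecker k (3 * q + 2) - 5 / 2 * kronecker k (3 * q + 1) := by
  funext k; rw [q3Diag, if_neg (by omega), if_neg (by omega), if_neg (by omega)]; rfl

theorem q3Diag_knot {K q : ℕ} (hq : q + 1 < K) : q3Diag K h (3 * q + 3) = fun k =>
    (15 * √5 - 18) / 4 * kronecker k (3 * q + 3)
      - (39 - 15 * √5) / 16 * (kronecker k (3 * q) + kronecker k (3 * q + 6)) := by
  funext k; rw [q3Diag, if_neg (by omega), if_pos (by omega)]; rfl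

theorem q3Upper_knot : q3Upper (3 * q) = fun k => kronecker k (3 * q) := by
  funext k; simp [q3Upper]

theorem q3Upper_left : q3Upper (3 * q + 1) = fun k =>
    kronecker k (3 * q + 1) - (15 - √5) / 20 * kronecker k (3 * q)
      - (5 - 2 * √5) / 5 * kronecker k (3 * q + 3) := by
  funext k; rw [q3Upper, if_neg (by omega), if_pos (by omega)]; rfl

theorem q3Upper_right : q3Upper (3 * q + 2) = fun k =>
    kronecker k (3 * q + 2) - (15 - √5) / 20 * kronecker k (3 * q + 3)
      - (5 - 2 * √5) / 5 * kronecker k (3 * q) := by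
  funext k; rw [q3Upper, if_neg (by omega), if_neg (by omega)]; rfl

theorem q3a_left (k : ℕ) : q3a (3 * q + 1) k =
    -(3 * √5 + 5) / 4 * kronecker k (3 * q) + 5 * kronecker k (3 * q + 1)
      - 5 / 2 * kronecker k (3 * q + 2) + (15 * √5 - 25) / 8 * kronecker k (3 * q + 3) := by
  unfold q3a kronecker
  rw [if_neg (by omega), if_pos (by omega)]
  split_ifs <;> first | omega | ring

theorem q3a_right (k : ℕ) : q3a (3 * q + 2) k =
    (15 * √5 - 25) / 8 * kronecker k (3 * q) - 5 / 2 * kronecker k (3 * q + 1)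
      + 5 * kronecker k (3 * q + 2) - (3 * √5 + 5) / 4 * kronecker k (3 * q + 3) := by
  unfold q3a kronecker
  rw [if_neg (by omega), if_neg (by omega)]
  split_ifs <;> first | omega | ring

theorem q3a_knot (k : ℕ) : q3a (3 * q + 3) k = 13 * kronecker k (3 * q + 3)
      - (15 * √5 + 25) / 8 * (kronecker k (3 * q + 2) + kronecker k (3 * q + 4))
      + (15 * √5 - 25) / 8 * (kronecker k (3 * q + 1) + kronecker k (3 * q + 5))
      - 1 / 4 * (kronecker k (3 * q) + kronecker k (3 * q + 6)) := by
  unfold q3a kronecker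
  rw [if_pos (by omega)]
  split_ifs <;> first | omega | ring

end Rows

/-- The indices from `0` to `3 * K` are the two end points, the interior points and the inner knots. -/
theorem q3_index_cases {K i : ℕ} (hi : i < 3 * K + 1) :
    i = 0 ∨ i = 3 * K ∨ (∃ q < K, i = 3 * q + 1) ∨ (∃ q < K, i = 3 * q + 2) ∨
      ∃ q, q + 1 < K ∧ i = 3 * q + 3 := by
  have h3 : i % 3 = 0 ∨ i % 3 = 1 ∨ i % 3 = 2 := by omega
  by_cases h0 : i = 0
  · exact Or.inl h0
  by_cases h1 : i = 3 * K
  · exact Or.inr (Or.inl h1)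
  rcases h3 with h3 | h3 | h3
  · exact Or.inr (Or.inr (Or.inr (Or.inr ⟨i / 3 - 1, by omega, by omega⟩)))
  · exact Or.inr (Or.inr (Or.inl ⟨i / 3, by omega, by omega⟩))
  · exact Or.inr (Or.inr (Or.inr (Or.inl ⟨i / 3, by omega, by omega⟩)))

theorem two_lt_sqrt_five : 2.2 < √5 := Real.lt_sqrt_of_sq_lt (by norm_num)

theorem sqrt_five_lt : √5 < 2.4 := (Real.sqrt_lt' (by norm_num)).2 (by norm_num)

/-- The square matrix with the given entries, indexed by `0` to `n - 1`. -/
def natMatrix (n : ℕ) (f : ℕ → ℕ → ℝ) : Matrix (Fin n) (Fin n) ℝ := fun i k => f i k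

theorem natMatrix_mul (n : ℕ) (f g : ℕ → ℕ → ℝ) :
    natMatrix n f * natMatrix n g =
      natMatrix n fun i k => ∑ j ∈ Finset.range n, f i j * g j k := by
  ext i k
  simp only [Matrix.mul_apply, natMatrix]
  exact Fin.sum_univ_eq_sum_range (fun j => f i j * g j k) n

theorem IsNonsingularMMatrix.natMatrix_of_pos (n : ℕ) (f : ℕ → ℕ → ℝ)
    (hZ : ∀ i < n, ∀ j, i ≠ j → f i j ≤ 0) (v : ℕ → ℝ) (hv : ∀ i, 0 < v i)
    (hfv : ∀ i < n, 0 < ∑ j ∈ Finset.range n, f i j * v j) :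
    IsNonsingularMMatrix (natMatrix n f) := by
  refine .of_mulVec_pos _ (fun i j hij => hZ i i.2 j (Fin.val_ne_of_ne hij)) (fun i => v i)
    (fun i => hv i) fun i => ?_
  have := hfv i i.2
  rwa [← Fin.sum_univ_eq_sum_range (fun j => f i j * v j) n] at this

theorem isNonsingularMMatrix_q3Lower (K : ℕ) :
    IsNonsingularMMatrix (natMatrix (3 * K + 1) (q3Lower K)) := by
  have h1 := two_lt_sqrt_five
  have h2 := sqrt_five_lt
  refine .natMatrix_of_pos _ _ (fun i _ j hij => ?_) (fun i => if i % 3 = 0 then 10 else 1)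
    (fun i => by split_ifs <;> norm_num) fun i hi => ?_
  · have k0 := kronecker_of_ne hij.symm
    unfold q3Lower
    split_ifs
    · rw [k0]
      have := mul_nonneg (a := (√5 + 5) / 4) (by linarith)
        (add_nonneg (kronecker_nonneg j (i - 1)) (kronecker_nonneg j (i + 1)))
      have := mul_nonneg (a := (5 - √5) / 4) (by linarith)
        (add_nonneg (kronecker_nonneg j (i - 2)) (kronecker_nonneg j (i + 2)))
      linarith
    · exact k0.le
  · rcases q3_index_cases hi with rfl | rfl | ⟨q, hq, rfl⟩ | ⟨q, hq, rfl⟩ | ⟨q, hq, rfl⟩ <;>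
      simp (disch := omega) only [q3Lower_zero, q3Lower_last, q3Lower_left, q3Lower_right,
        q3Lower_knot, sub_mul, add_mul, mul_add, mul_assoc, Finset.sum_sub_distrib,
        Finset.sum_add_distrib, ← Finset.mul_sum, sum_kronecker_mul, if_pos, if_neg, ↓reduceIte] <;>
      linarith

theorem isNonsingularMMatrix_q3Diag (K : ℕ) (h : ℝ) (hh : 0 < h) :
    IsNonsingularMMatrix (natMatrix (3 * K + 1) (q3Diag K h)) := by
  have h1 := two_lt_sqrt_five
  have h2 := sqrt_five_lt
  have h3 : 0 < h ^ 2 := by positivity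
  refine .natMatrix_of_pos _ _ (fun i _ j hij => ?_) (fun _ => 1) (fun _ => one_pos)
    fun i hi => ?_
  · have k0 := kronecker_of_ne hij.symm
    unfold q3Diag
    rw [k0]
    split_ifs
    · simp
    · have := mul_nonneg (a := (39 - 15 * √5) / 16) (by linarith)
        (add_nonneg (kronecker_nonneg j (i - 3)) (kronecker_nonneg j (i + 3)))
      linarith
    · linarith [kronecker_nonneg j (i + 1)]
    · linarith [kronecker_nonneg j (i - 1)]
  · rcases q3_index_cases hi with rfl | rfl | ⟨q, hq, rfl⟩ | ⟨q, hq, rfl⟩ | ⟨q, hq, rfl⟩ <;>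
      simp (disch := omega) only [q3Diag_zero, q3Diag_last, q3Diag_left, q3Diag_right,
        q3Diag_knot, sub_mul, add_mul, mul_add, mul_assoc, Finset.sum_sub_distrib,
        Finset.sum_add_distrib, ← Finset.mul_sum, sum_kronecker_mul] <;>
      linarith

theorem isNonsingularMMatrix_q3Upper (K : ℕ) :
    IsNonsingularMMatrix (natMatrix (3 * K + 1) q3Upper) := by
  have h1 := two_lt_sqrt_five
  have h2 := sqrt_five_lt
  have h3 : 0 ≤ (5 - 2 * √5) / 5 := by linarith
  have h4 : 0 ≤ (15 - √5) / 20 := by linarith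
  refine .natMatrix_of_pos _ _ (fun i _ j hij => ?_) (fun _ => 1) (fun _ => one_pos)
    fun i hi => ?_
  · have k0 := kronecker_of_ne hij.symm
    unfold q3Upper
    rw [k0]
    split_ifs
    · exact le_rfl
    · linarith [mul_nonneg h4 (kronecker_nonneg j (i - 1)),
        mul_nonneg h3 (kronecker_nonneg j (i + 2))]
    · linarith [mul_nonneg h4 (kronecker_nonneg j (i + 1)),
        mul_nonneg h3 (kronecker_nonneg j (i - 2))]
  · obtain ⟨q, rfl | rfl | rfl⟩ : ∃ q, i = 3 * q ∨ i = 3 * q + 1 ∨ i = 3 * q + 2 :=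
      ⟨i / 3, by omega⟩
    · simp (disch := omega) only [q3Upper_knot, sum_kronecker_mul, one_pos]
    all_goals
      by_cases hq : 3 * q + 3 < 3 * K + 1
      · simp (disch := omega) only [q3Upper_left, q3Upper_right, sub_mul, mul_assoc,
          Finset.sum_sub_distrib, ← Finset.mul_sum, sum_kronecker_mul]
        linarith
      · omega

/-- The block LDU factorization of the `Q³` matrix that eliminates the interior points. -/
theorem q3Matrix1D_eq_mul (K : ℕ) (h : ℝ) :
    q3Matrix1D K h = natMatrix (3 * K + 1) (q3Lower K) * natMatrix (3 * K + 1) (q3Diag K h) *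
      natMatrix (3 * K + 1) q3Upper := by
  have hs : √5 ^ 2 = 5 := Real.sq_sqrt (by norm_num)
  rw [Matrix.mul_assoc, natMatrix_mul, natMatrix_mul]
  ext ⟨i, hi⟩ ⟨k, hk⟩
  simp only [natMatrix, q3Matrix1D, Fin.mk.injEq]
  have upper₃ (q : ℕ) : q3Upper (3 * q + 3) = fun k => kronecker k (3 * q + 3) :=
    q3Upper_knot (q + 1)
  have upper₄ (q : ℕ) : q3Upper (3 * q + 4) = _ := q3Upper_left (q + 1)
  have upper₅ (q : ℕ) : q3Upper (3 * q + 5) = _ := q3Upper_right (q + 1)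
  have upper₆ (q : ℕ) : q3Upper (3 * q + 6) = fun k => kronecker k (3 * q + 6) :=
    q3Upper_knot (q + 2)
  have diag₄ (q : ℕ) : q3Diag K h (3 * q + 4) = _ := q3Diag_left K (q + 1) h
  have diag₅ (q : ℕ) : q3Diag K h (3 * q + 5) = _ := q3Diag_right K (q + 1) h
  have upper₀ : q3Upper 0 = fun k => kronecker k 0 := q3Upper_knot 0
  rcases q3_index_cases hi with rfl | rfl | ⟨q, hq, rfl⟩ | ⟨q, hq, rfl⟩ | ⟨q, hq, rfl⟩
  · simp (disch := omega) only [q3Lower_zero, q3Diag_zero, upper₀, mul_assoc,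
      ← Finset.mul_sum, sum_kronecker_mul]
    simp [kronecker]
  · simp (disch := omega) only [q3Lower_last, q3Diag_last, q3Upper_knot, mul_assoc,
      ← Finset.mul_sum, sum_kronecker_mul]
    simp [kronecker]
  · rw [if_neg (by omega), q3a_left]
    simp (disch := omega) only [q3Lower_left, q3Diag_left, q3Upper_left, q3Upper_right,
      sub_mul, mul_assoc, Finset.sum_sub_distrib, ← Finset.mul_sum, sum_kronecker_mul]
    ring
  · rw [if_neg (by omega), q3a_right]
    simp (disch := omega) only [q3Lower_right, q3Diag_right, q3Upper_left, q3Upper_right,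
      sub_mul, mul_assoc, Finset.sum_sub_distrib, ← Finset.mul_sum, sum_kronecker_mul]
    ring
  · rw [if_neg (by omega), q3a_knot]
    simp (disch := omega) only [q3Lower_knot, q3Diag_knot, q3Diag_left, q3Diag_right,
      diag₄, diag₅, add_assoc, Nat.reduceAdd, Nat.reduceMul,
      sub_mul, add_mul, mul_add, mul_assoc, Finset.sum_sub_distrib, Finset.sum_add_distrib,
      ← Finset.mul_sum, sum_kronecker_mul,
      q3Upper_left, q3Upper_right, q3Upper_knot, upper₃, upper₄, upper₅, upper₆]
    ring_nf
    simp only [hs]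
    ring

/-- the matrix of the 1D `Q³` variational difference scheme is a product
of three nonsingular M-matrices; in particular it is inverse positive. -/
theorem stmt12 (K : ℕ) (hK : 2 ≤ K) (h : ℝ) (hh : 0 < h) :
    (∃ M1 M2 M3 : Matrix (Fin (3 * K + 1)) (Fin (3 * K + 1)) ℝ,
        IsNonsingularMMatrix M1 ∧ IsNonsingularMMatrix M2 ∧ IsNonsingularMMatrix M3 ∧
        q3Matrix1D K h = M1 * M2 * M3) ∧
      IsUnit (q3Matrix1D K h) ∧ ∀ i k, 0 ≤ (q3Matrix1D K h)⁻¹ i k := by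
  have h1 := isNonsingularMMatrix_q3Lower K
  have h2 := isNonsingularMMatrix_q3Diag K h hh
  have h3 := isNonsingularMMatrix_q3Upper K
  have hmul := q3Matrix1D_eq_mul K h
  refine ⟨⟨_, _, _, h1, h2, h3, hmul⟩, ?_, fun i k => ?_⟩
  · rw [hmul]
    exact (h1.2.1.mul h2.2.1).mul h3.2.1
  · rw [hmul, Matrix.mul_inv_rev, Matrix.mul_inv_rev, Matrix.mul_apply]
    refine Finset.sum_nonneg fun j _ => mul_nonneg (h3.2.2 i j) ?_
    rw [Matrix.mul_apply]
    exact Finset.sum_nonneg fun l _ => mul_nonneg (h2.2.2 j l) (h1.2.2 l k)
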